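/- arXiv:1203.3851 — 3 statements merged into one kernel-verified Lean document; each statement's English description precedes it below -/
import Mathlib

section
/- Let K be a field, X a finite set, and G a finite group acting on X such that the action is free (if g • x = x for some x ∈ X then g = 1). Suppose ρ : G → GL_K(Maps(X,K)) is a group homomorphism into the K-linear automorphisms of the space of K-valued functions on X such that for every g ∈ G and every x ∈ X one has ρ(g)(δ_x) = c(g,x) · δ_{g • x} for some nonzero scalar c(g,x) ∈ K. Then the K-dimension of the fixed subspace {f ∈ Maps(X,K) : ρ(g)(f) = f for all g ∈ G} equals the number of G-orbits on X. -/
open scoped Classical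

/-- The indicator function `δ_x` of a point `x`. -/
noncomputable def delta (K : Type*) [Field K] {X : Type*} (x : X) : X → K :=
  fun y => if y = x then 1 else 0

/-- The fixed subspace of `Maps(X,K)` under a linear representation `ρ`. -/
noncomputable def fixedSub (K : Type*) [Field K] (X : Type*) (G : Type*) [Group G]
    (ρ : G →* ((X → K) ≃ₗ[K] (X → K))) : Submodule K (X → K) where
  carrier := {f | ∀ g : G, ρ g f = f}
  add_mem' := by intro f g hf hg u; rw [map_add, hf u, hg u]
  zero_mem' := by intro u; exact map_zero _
  smul_mem' := by intro c f hf u; rw [map_smul, hf u]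

/-- A linear map that is monomial over the permutation `x ↦ g • x` rescales the values of functions
along that permutation. -/
theorem exists_unit_apply_smul_eq_of_monomial {K X G : Type*} [Field K] [Finite X] [Group G]
    [MulAction G X] (g : G) (T : (X → K) →ₗ[K] (X → K))
    (hT : ∀ x : X, ∃ c : Kˣ, T (delta K x) = (c : K) • delta K (g • x)) (x : X) :
    ∃ c : Kˣ, ∀ f : X → K, T f (g • x) = c * f x := by
  have := Fintype.ofFinite X
  choose c hc using hT
  refine ⟨c x, fun f => ?_⟩
  have hf : f = ∑ y, f y • delta K y := by
    ext z
    simp [delta]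
  conv_lhs => rw [hf]
  simp [hc, delta]
  ring

/-- The sum of a vector over all translates by a representation is fixed. -/
theorem sum_translates_mem_fixedSub {K X G : Type*} [Field K] [Group G] [Fintype G]
    (ρ : G →* ((X → K) ≃ₗ[K] (X → K))) (u : X → K) :
    ∑ g, ρ g u ∈ fixedSub K X G ρ := by
  intro h
  rw [map_sum]
  simp only [← LinearEquiv.mul_apply, ← map_mul]
  exact Fintype.sum_equiv (Equiv.mulLeft h) _ _ fun _ => rfl

/-- A finite group acting **freely** on a finite set `X`, represented on `Maps(X,K)` by
monomial matrices covering the permutation action, has fixed space of dimension equal to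
the number of orbits. -/
theorem finrank_fixedSub_monomial_eq_card_orbits
    (K : Type*) [Field K] (X : Type*) [Finite X]
    (G : Type*) [Group G] [Finite G] [MulAction G X]
    (hfree : ∀ (g : G) (x : X), g • x = x → g = 1)
    (ρ : G →* ((X → K) ≃ₗ[K] (X → K)))
    (hmono : ∀ (g : G) (x : X), ∃ c : Kˣ,
      ρ g (delta K x) = (c : K) • delta K (g • x)) :
    Module.finrank K (fixedSub K X G ρ)
      = Nat.card (Quotient (MulAction.orbitRel G X)) := by
  have := Fintype.ofFinite G
  have hscale (g : G) := exists_unit_apply_smul_eq_of_monomial g (ρ g : (X → K) →ₗ[K] (X → K))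
    (hmono g)
  let R : fixedSub K X G ρ →ₗ[K] (Quotient (MulAction.orbitRel G X) → K) :=
    LinearMap.funLeft K K Quotient.out ∘ₗ (fixedSub K X G ρ).subtype
  have hinj : Function.Injective R := by
    refine (injective_iff_map_eq_zero R).2 fun f hf => Subtype.ext (funext fun x => ?_)
    obtain ⟨g, hg⟩ : x ∈ MulAction.orbit G (Quotient.out (s := MulAction.orbitRel G X) ⟦x⟧) :=
      MulAction.orbitRel_apply.1 ((MulAction.orbitRel G X).symm' (Quotient.mk_out x))
    obtain ⟨c, hc⟩ := hscale g (Quotient.out (s := MulAction.orbitRel G X) ⟦x⟧)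
    have hx : f.1 (Quotient.out (s := MulAction.orbitRel G X) ⟦x⟧) = 0 := congrFun hf ⟦x⟧
    have hfix : ρ g f.1 = f.1 := f.2 g
    specialize hc f.1
    rw [LinearEquiv.coe_coe, hfix, hx, mul_zero] at hc
    exact hg ▸ hc
  have hsurj : Function.Surjective R := by
    intro h
    let u : X → K := fun x =>
      if Quotient.out (s := MulAction.orbitRel G X) ⟦x⟧ = x then h ⟦x⟧ else 0
    refine ⟨⟨_, sum_translates_mem_fixedSub ρ u⟩, funext fun q => ?_⟩
    change (∑ g, ρ g u) q.out = h q
    rw [Finset.sum_apply, Finset.sum_eq_single 1]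
    · simp [u]
    · intro g _ hg
      obtain ⟨c, hc⟩ := hscale g (g⁻¹ • q.out)
      specialize hc u
      rw [smul_inv_smul, LinearEquiv.coe_coe] at hc
      have hq : (⟦g⁻¹ • q.out⟧ : Quotient (MulAction.orbitRel G X)) = q := by
        conv_rhs => rw [← q.out_eq]
        exact Quotient.sound (MulAction.orbitRel_apply.2 (MulAction.mem_orbit _ _))
      have hne : q.out ≠ g⁻¹ • q.out := fun e => hg (inv_eq_one.1 (hfree _ _ e.symm))
      rw [hc]
      simp [u, hq, hne]
    · simp
  have := Fintype.ofFinite (Quotient (MulAction.orbitRel G X))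
  rw [(LinearEquiv.ofBijective R ⟨hinj, hsurj⟩).finrank_eq, Module.finrank_fintype_fun_eq_card,
    Nat.card_eq_fintype_card]
end

section
/- Let C be a finite subgroup of Γ_A whose intersection with the kernel of π : Γ_A → Aut(A) is trivial, and let C̄ = π(C) ⊆ Aut(A). Let V ⊆ Maps(A,K) be the subspace of functions vanishing at every element of A that does not generate A. Then V is stable under the action of C, and the K-dimension of the fixed subspace V^C = {f ∈ V : σ • f = f for all σ ∈ C} equals the number of orbits of C̄ on the set of generators of A. (This is the computation 3.2.14–3.2.21 in the proof of Lemma 3.2 of the paper.) -/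
open scoped Classical

variable (K : Type*) [Field K] (A : Type*) [Group A]

/-- The action of `Aut(A)` on the character group `A →* Kˣ` by `α • ψ = ψ ∘ α⁻¹`. -/
noncomputable def charAut : MulAut A →* MulAut (A →* Kˣ) where
  toFun α :=
    { toFun := fun ψ => ψ.comp α.symm.toMonoidHom
      invFun := fun ψ => ψ.comp α.toMonoidHom
      left_inv := fun ψ => by ext a; simp
      right_inv := fun ψ => by ext a; simp
      map_mul' := fun ψ φ => by ext a; simp }
  map_one' := by ext ψ a; simp [MulAut.one_def]
  map_mul' := fun α β => by ext ψ a; simp [MulAut.mul_def, MulEquiv.symm_trans_apply]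

/-- The group `Γ_A = (A →* Kˣ) ⋊ Aut(A)`. -/
noncomputable abbrev Gam := (A →* Kˣ) ⋊[charAut K A] (MulAut A)

/-- The `K`-linear action of `Γ_A` on `Maps(A, K)`:
`((ψ, α) • f) a = ψ a * f (α⁻¹ a)`. -/
noncomputable def act (σ : Gam K A) : (A → K) →ₗ[K] (A → K) where
  toFun f a := (σ.left a : K) * f (σ.right.symm a)
  map_add' f g := by funext a; simp [mul_add]
  map_smul' c f := by funext a; simp only [Pi.smul_apply, smul_eq_mul, RingHom.id_apply]; ring

/-- The fixed subspace of `Maps(A, K)` under a set of elements of `Γ_A`. -/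
noncomputable def fixedSpace (S : Set (Gam K A)) : Submodule K (A → K) where
  carrier := {f | ∀ σ ∈ S, act K A σ f = f}
  add_mem' := by intro f g hf hg σ hσ; rw [map_add, hf σ hσ, hg σ hσ]
  zero_mem' := by intro σ hσ; exact map_zero _
  smul_mem' := by intro c f hf σ hσ; rw [map_smul, hf σ hσ]

/-- The subspace `V` of `Maps(A,K)` of functions vanishing at every non-generator of `A`. -/
noncomputable def genSupport : Submodule K (A → K) where
  carrier := {f | ∀ a : A, Subgroup.zpowers a ≠ ⊤ → f a = 0}
  add_mem' := by
    intro f g hf hg a ha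
    simp only [Pi.add_apply, hf a ha, hg a ha, add_zero]
  zero_mem' := by intro a ha; rfl
  smul_mem' := by
    intro c f hf a ha
    simp only [Pi.smul_apply, hf a ha, smul_zero]

section Helpers

variable {K A}

theorem act_apply (σ : Gam K A) (f : A → K) (a : A) :
    act K A σ f a = (σ.left a : K) * f (σ.right.symm a) := rfl

theorem act_one (f : A → K) : act K A 1 f = f := by
  funext a
  simp [act_apply, MulAut.one_def]

theorem act_mul (σ τ : Gam K A) (f : A → K) :
    act K A (σ * τ) f = act K A σ (act K A τ f) := by
  funext a
  simp [act_apply, charAut, MulAut.mul_def, mul_assoc]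

theorem zpowers_mulAut_apply (α : MulAut A) (a : A) :
    Subgroup.zpowers (α a) = ⊤ ↔ Subgroup.zpowers a = ⊤ := by
  have h : Subgroup.zpowers (α a) = (Subgroup.zpowers a).map (α : A →* A) := by
    rw [MonoidHom.map_zpowers]
    rfl
  have htop : (⊤ : Subgroup A).map (α : A →* A) = ⊤ :=
    Subgroup.map_top_of_surjective _ α.surjective
  rw [h]
  constructor
  · intro h'
    exact Subgroup.map_injective (f := (α : A →* A)) α.injective (h'.trans htop.symm)
  · intro h'
    rw [h', htop]

theorem act_mem_genSupport (σ : Gam K A) {f : A → K} (hf : f ∈ genSupport K A) :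
    act K A σ f ∈ genSupport K A := by
  intro a ha
  rw [act_apply, hf, mul_zero]
  intro h
  exact ha ((zpowers_mulAut_apply σ.right.symm a).mp h)

/-- An automorphism fixing a generator is the identity. -/
theorem mulAut_eq_one_of_apply_generator {α : MulAut A} {a : A}
    (ha : Subgroup.zpowers a = ⊤) (h : α a = a) : α = 1 := by
  ext b
  obtain ⟨n, rfl⟩ : b ∈ Subgroup.zpowers a := ha ▸ Subgroup.mem_top b
  simp [h]

theorem sum_act_mem_fixedSpace (C : Subgroup (Gam K A)) [Fintype C] (h : A → K) :
    ∑ σ : C, act K A σ h ∈ fixedSpace K A (C : Set (Gam K A)) := by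
  intro τ hτ
  rw [map_sum]
  simp_rw [← act_mul]
  exact Equiv.sum_comp (Equiv.mulLeft (⟨τ, hτ⟩ : C)) fun σ : C => act K A σ h

theorem apply_eq_zero_of_mem_fixedSpace {S : Set (Gam K A)} {f : A → K}
    (hf : f ∈ fixedSpace K A S) {σ : Gam K A} (hσ : σ ∈ S) {a : A} (ha : f a = 0) :
    f (σ.right a) = 0 := by
  rw [← hf σ hσ, act_apply, MulEquiv.symm_apply_apply, ha, mul_zero]

end Helpers

/-- **3.2.14–3.2.21 in the proof of Lemma 3.2.** For a finite subgroup `C ≤ Γ_A` meeting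
`ker π` trivially, the subspace `V` of functions supported on the generators of `A` is
`C`-stable, and `dim_K V^C` equals the number of orbits of `C̄ = π(C)` on the set of
generators of `A`. -/
theorem finrank_genSupport_fixed_eq_card_orbits
    [IsAlgClosed K] [CharZero K] [Finite A] [IsCyclic A]
    (C : Subgroup (Gam K A)) (hCfin : (C : Set (Gam K A)).Finite)
    (htriv : C ⊓ MonoidHom.ker (SemidirectProduct.rightHom : Gam K A →* MulAut A) = ⊥) :
    (∀ σ ∈ C, ∀ f ∈ genSupport K A, act K A σ f ∈ genSupport K A) ∧
    Module.finrank K ↥(genSupport K A ⊓ fixedSpace K A (C : Set (Gam K A)))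
      = Nat.card {S : Set A | ∃ a : A, Subgroup.zpowers a = ⊤ ∧
          S = {b | ∃ τ ∈ C.map (SemidirectProduct.rightHom : Gam K A →* MulAut A),
                τ a = b}} := by
  refine ⟨fun σ _ f hf => act_mem_genSupport σ hf, ?_⟩
  set D : Subgroup (MulAut A) :=
    C.map (SemidirectProduct.rightHom : Gam K A →* MulAut A)
  have horb : ∀ a : A, {b | ∃ τ ∈ D, τ a = b} = MulAction.orbit D a := by
    intro a
    ext b
    simp [MulAction.mem_orbit_iff, Subgroup.smul_def]
  simp_rw [horb]
  let T : Set (Set A) :=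
    {S | ∃ a : A, Subgroup.zpowers a = ⊤ ∧ S = MulAction.orbit D a}
  let _ : Fintype T := Fintype.ofFinite T
  let _ : Fintype C := hCfin.fintype
  choose r hr_gen hr_orb using fun S : T => S.2
  have r_inj : ∀ S S' : T, r S' ∈ MulAction.orbit D (r S) → S = S' := by
    intro S S' h
    apply Subtype.ext
    rw [hr_orb S, hr_orb S', MulAction.orbit_eq_iff.mpr h]
  have eq_one : ∀ σ ∈ C, σ.right = 1 → σ = 1 := by
    intro σ hσ h
    have : σ ∈ C ⊓ MonoidHom.ker (SemidirectProduct.rightHom : Gam K A →* MulAut A) :=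
      ⟨hσ, h⟩
    rwa [htriv, Subgroup.mem_bot] at this
  let ev : ↥(genSupport K A ⊓ fixedSpace K A (C : Set (Gam K A))) →ₗ[K] (T → K) :=
    (LinearMap.funLeft K K r).comp (Submodule.subtype _)
  have ev_inj : Function.Injective ev := by
    rw [injective_iff_map_eq_zero]
    rintro ⟨f, hfV, hfC⟩ hf
    apply Subtype.ext
    funext b
    by_cases hb : Subgroup.zpowers b = ⊤
    · let S : T := ⟨MulAction.orbit D b, b, hb, rfl⟩
      have hbS : b ∈ MulAction.orbit D (r S) := by
        rw [← hr_orb S]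
        exact MulAction.mem_orbit_self b
      obtain ⟨⟨_, σ, hσ, rfl⟩, hσb⟩ := hbS
      have hzero : f (σ.right (r S)) = 0 :=
        apply_eq_zero_of_mem_fixedSpace hfC hσ (congrFun hf S)
      exact (congrArg f hσb).symm.trans hzero
    · exact hfV b hb
  have ev_surj : Function.Surjective ev := by
    intro g
    let h : A → K := fun a => ∑ S : T, if r S = a then g S else 0
    have hV : h ∈ genSupport K A := by
      intro a ha
      refine Finset.sum_eq_zero fun S _ => if_neg ?_
      rintro rfl
      exact ha (hr_gen S)
    refine ⟨⟨∑ σ : C, act K A σ h,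
      Submodule.sum_mem _ fun σ _ => act_mem_genSupport (σ : Gam K A) hV,
      sum_act_mem_fixedSpace C h⟩, ?_⟩
    funext S
    change (∑ σ : C, act K A σ h) (r S) = g S
    rw [Finset.sum_apply, Finset.sum_eq_single (1 : C)]
    · rw [OneMemClass.coe_one, act_one]
      refine (Finset.sum_eq_single S (fun S' _ hne => if_neg fun h' => hne ?_) ?_).trans
        (if_pos rfl)
      · exact r_inj S' S (h' ▸ MulAction.mem_orbit_self _)
      · simp
    · intro σ _ hσ
      rw [act_apply]
      refine mul_eq_zero_of_right _ (Finset.sum_eq_zero fun S' _ => if_neg fun h' => hσ ?_)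
      have hmove : (σ : Gam K A).right (r S') = r S := by
        rw [h', MulEquiv.apply_symm_apply]
      have hS : S' = S := r_inj S' S ⟨⟨_, σ, σ.2, rfl⟩, hmove⟩
      rw [hS] at hmove
      exact Subtype.ext
        (eq_one σ σ.2 (mulAut_eq_one_of_apply_generator (hr_gen S) hmove))
    · simp
  rw [(LinearEquiv.ofBijective ev ⟨ev_inj, ev_surj⟩).finrank_eq,
    Module.finrank_fintype_fun_eq_card, Nat.card_eq_fintype_card]
end

section
/- Let A be a finite cyclic group, D a subgroup of A, and K an algebraically closed field of characteristic zero. Let N = {ψ ∈ (A →* Kˣ) : ψ(d) = 1 for all d ∈ D} be the annihilator of D, acting on the free K-module K[(A →* Kˣ)] with basis the characters of A by translation of basis elements: ν • [ψ] = [ν·ψ]. Then the K-linear map K[(A →* Kˣ)] → K[(D →* Kˣ)] sending each basis element [ψ] to [ψ|_D] restricts to a K-linear isomorphism from the submodule of N-fixed elements onto K[(D →* Kˣ)]. (This is the isomorphism 3.1.4 of the paper, written over K.) -/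
open scoped Classical

variable (K : Type*) [Field K] (A : Type*) [CommGroup A]

/-- The submodule of `K[(A →* Kˣ)]` of elements fixed by translation by every character in
the annihilator `N = {ψ : ψ|_D = 1}` of a subgroup `D ≤ A`. -/
noncomputable def annFixed (D : Subgroup A) : Submodule K ((A →* Kˣ) →₀ K) where
  carrier := {x | ∀ ν : A →* Kˣ, (∀ d ∈ D, ν d = 1) →
      Finsupp.mapDomain (fun ψ => ν * ψ) x = x}
  add_mem' := by
    intro x y hx hy ν hν
    rw [Finsupp.mapDomain_add, hx ν hν, hy ν hν]
  zero_mem' := by intro ν hν; simp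
  smul_mem' := by
    intro c x hx ν hν
    rw [Finsupp.mapDomain_smul, hx ν hν]

/-- The value of `Finsupp.mapDomain f x` at `f a`, for `x` constant on the fibres of `f`. -/
theorem Finsupp.mapDomain_apply_of_constant_on_fibres {R α β : Type*} [Semiring R] [Fintype α]
    (f : α → β) (x : α →₀ R) (hx : ∀ a a', f a = f a' → x a = x a') (a : α) :
    Finsupp.mapDomain f x (f a) = (Finset.univ.filter fun a' => f a' = f a).card * x a := by
  rw [Finsupp.mapDomain, Finsupp.sum_fintype _ _ (by simp), Finsupp.finsetSum_apply]
  simp only [Finsupp.single_apply]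
  rw [← Finset.sum_filter, Finset.sum_congr rfl (g := fun _ => x a)
    fun a' ha' => hx a' a (Finset.mem_filter.mp ha').2]
  simp

/-- An element of `K[(A →* Kˣ)]` is fixed by the annihilator of `D` if and only if its
coefficients depend only on the restrictions of the characters to `D`. -/
theorem mem_annFixed_iff (D : Subgroup A) (x : (A →* Kˣ) →₀ K) :
    x ∈ annFixed K A D ↔
      ∀ φ ψ : A →* Kˣ, φ.comp D.subtype = ψ.comp D.subtype → x φ = x ψ := by
  constructor
  · intro hx φ ψ h
    have hν : ∀ d ∈ D, (φ * ψ⁻¹) d = 1 := fun d hd => by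
      simpa [mul_inv_eq_one] using DFunLike.congr_fun h ⟨d, hd⟩
    have key := Finsupp.mapDomain_apply (mul_right_injective (φ * ψ⁻¹)) x ψ
    rw [hx _ hν] at key
    rwa [show φ * ψ⁻¹ * ψ = φ from inv_mul_cancel_right φ ψ] at key
  · intro hx ν hν
    ext1 φ
    have key := Finsupp.mapDomain_apply (mul_right_injective ν) x (ν⁻¹ * φ)
    rw [show ν * (ν⁻¹ * φ) = φ from mul_inv_cancel_left ν φ] at key
    rw [key]
    refine hx _ _ (MonoidHom.ext fun d => ?_)
    simp [hν d d.2]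

/-- **The isomorphism 3.1.4** (written over `K`): the linear map
`K[(A →* Kˣ)] → K[(D →* Kˣ)]`, `[ψ] ↦ [ψ|_D]`, restricts to a `K`-linear isomorphism from
the submodule of `N`-fixed elements onto `K[(D →* Kˣ)]`, where `N` is the annihilator of
`D`. -/
theorem bijective_restriction_on_annFixed
    [IsAlgClosed K] [CharZero K] [Finite A] [IsCyclic A] (D : Subgroup A) :
    Function.Bijective
      ((Finsupp.lmapDomain K K
          (fun ψ : A →* Kˣ => ψ.comp D.subtype)).domRestrict (annFixed K A D)) := by
  have := Fintype.ofFinite (A →* Kˣ)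
  have hsurj : Function.Surjective fun ψ : A →* Kˣ => ψ.comp D.subtype :=
    MonoidHom.domRestrict_surjective K D
  have hcard : ∀ φ : A →* Kˣ,
      ((Finset.univ.filter fun ψ : A →* Kˣ =>
        ψ.comp D.subtype = φ.comp D.subtype).card : K) ≠ 0 := fun φ =>
    Nat.cast_ne_zero.mpr (Finset.card_ne_zero_of_mem (a := φ) (by simp))
  constructor
  · rw [injective_iff_map_eq_zero]
    rintro ⟨x, hx⟩ h
    rw [mem_annFixed_iff] at hx
    ext φ
    have key := Finsupp.mapDomain_apply_of_constant_on_fibres _ x hx φ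
    rw [show Finsupp.mapDomain (fun ψ : A →* Kˣ => ψ.comp D.subtype) x = 0 from h] at key
    exact (mul_eq_zero.mp key.symm).resolve_left (hcard φ)
  · intro y
    let x : (A →* Kˣ) →₀ K := Finsupp.equivFunOnFinite.symm fun φ =>
      ((Finset.univ.filter fun ψ : A →* Kˣ =>
        ψ.comp D.subtype = φ.comp D.subtype).card : K)⁻¹ * y (φ.comp D.subtype)
    have hx : ∀ φ ψ : A →* Kˣ, φ.comp D.subtype = ψ.comp D.subtype → x φ = x ψ :=
      fun φ ψ h => by simp [x, h]
    refine ⟨⟨x, (mem_annFixed_iff K A D x).mpr hx⟩, Finsupp.ext fun χ => ?_⟩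
    obtain ⟨φ, rfl⟩ := hsurj χ
    exact (Finsupp.mapDomain_apply_of_constant_on_fibres _ x hx φ).trans
      (mul_inv_cancel_left₀ (hcard φ) _)
end
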